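/- Let 1 < s < 2 < r. Then there exist T > 0 and a continuously differentiable function u : [0,∞) → ℝ, twice differentiable on (0,∞), such that u is not identically zero, u(0) > 0, u satisfies −u''(t) + u(t) = |u(t)|^{r−2}u(t) − |u(t)|^{s−2}u(t) for all t ∈ (0,∞), and u(t) = 0 for all t ≥ T. In particular, the equation −u'' + u = |u|^{r−2}u − |u|^{s−2}u fails the unique continuation property on (0,∞). -/

import Mathlib

open Set

/-- The power of the positive part is differentiable for exponents above `1`. -/
lemma hasDerivAt_max_zero_rpow (x : ℝ) {p : ℝ} (hp : 1 < p) :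
    HasDerivAt (fun x : ℝ => max x 0 ^ p) (p * max x 0 ^ (p - 1)) x := by
  rcases lt_trichotomy x 0 with hx | rfl | hx
  · rw [max_eq_right hx.le, Real.zero_rpow (by linarith), mul_zero]
    refine (hasDerivAt_const x (0 : ℝ)).congr_of_eventuallyEq ?_
    filter_upwards [Iio_mem_nhds hx] with y hy
    rw [max_eq_right (le_of_lt hy), Real.zero_rpow (by linarith)]
  · rw [← hasDerivWithinAt_univ, ← Iic_union_Ici (a := (0 : ℝ))]
    have h0 : p * max (0 : ℝ) 0 ^ (p - 1) = 0 := by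
      rw [max_self, Real.zero_rpow (by linarith), mul_zero]
    refine HasDerivWithinAt.union ?_ ?_
    · rw [h0]
      refine (hasDerivWithinAt_const (0 : ℝ) _ (0 : ℝ)).congr (fun y hy => ?_) ?_
      · rw [max_eq_right hy, Real.zero_rpow (by linarith)]
      · rw [max_self, Real.zero_rpow (by linarith)]
    · rw [max_self]
      refine (Real.hasDerivAt_rpow_const (Or.inr hp.le)).hasDerivWithinAt.congr
        (fun y hy => ?_) ?_
      · rw [max_eq_left hy]
      · rw [max_self]
  · rw [max_eq_left hx.le]
    refine (Real.hasDerivAt_rpow_const (Or.inr hp.le)).congr_of_eventuallyEq ?_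
    filter_upwards [Ioi_mem_nhds hx] with y hy
    rw [max_eq_left (le_of_lt hy)]

/-- The second derivative of `w₊ ^ (2 / (2 - s))` for a solution of `w' = -(2 - s) / 2 * √(H w)`,
where `H x = 2 / s + x ^ 2 - 2 / r * |x| ^ (2 * (r - s) / (2 - s))`, written at `x = w t`. The
equation for `w` is regular at `w = 0`. -/
lemma mixed_power_identity {s r x : ℝ} (hs1 : 1 < s) (hs2 : s < 2) (hr : 2 < r) :
    2 / (2 - s) * ((2 / (2 - s) - 1) * max x 0 ^ (2 / (2 - s) - 1 - 1)) *
        (((2 - s) / 2) ^ 2 * (2 / s + x ^ 2 - 2 / r * |x| ^ (2 * (r - s) / (2 - s)))) +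
      2 / (2 - s) * max x 0 ^ (2 / (2 - s) - 1) *
        (((2 - s) / 2) ^ 2 * (x - 1 / r * (2 * (r - s) / (2 - s) *
          |x| ^ (2 * (r - s) / (2 - s) - 2) * x))) =
    max x 0 ^ (2 / (2 - s)) +
      |max x 0 ^ (2 / (2 - s))| ^ (s - 2) * max x 0 ^ (2 / (2 - s)) -
      |max x 0 ^ (2 / (2 - s))| ^ (r - 2) * max x 0 ^ (2 / (2 - s)) := by
  have h2s : 0 < 2 - s := by linarith
  have hβ : 2 / (2 - s) - 2 = 2 * (s - 1) / (2 - s) := by field_simp; ring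
  have hβpos : 0 < 2 / (2 - s) - 2 := by
    rw [hβ]; exact div_pos (by linarith) h2s
  rcases le_or_gt x 0 with hx | hx
  · rw [max_eq_right hx, Real.zero_rpow (by linarith), Real.zero_rpow (by linarith),
      Real.zero_rpow (by linarith)]
    simp
  · rw [max_eq_left hx.le, abs_of_pos hx, abs_of_pos (Real.rpow_pos_of_pos hx _)]
    have e1 : ∀ q : ℝ, (x ^ (2 / (2 - s))) ^ (q - 2) * x ^ (2 / (2 - s)) =
        x ^ (2 * (q - 1) / (2 - s)) := by
      intro q
      rw [← Real.rpow_mul hx.le, ← Real.rpow_add hx]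
      congr 1; field_simp; ring
    rw [e1, e1]
    set A := x ^ (2 * (s - 1) / (2 - s)) with hA
    set B := x ^ (2 * (r - s) / (2 - s)) with hB
    have e2 : x ^ (2 / (2 - s) - 1 - 1) = A := by rw [hA, ← hβ]; congr 1; ring
    have e3 : x ^ (2 / (2 - s) - 1) = A * x := by
      rw [hA, ← hβ]; nth_rw 3 [← Real.rpow_one x]; rw [← Real.rpow_add hx]; congr 1; ring
    have e4 : x ^ (2 / (2 - s)) = A * x ^ 2 := by
      rw [hA, ← hβ, ← Real.rpow_two, ← Real.rpow_add hx]; congr 1; ring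
    have e5 : x ^ (2 * (r - 1) / (2 - s)) = A * B := by
      rw [hA, hB, ← Real.rpow_add hx]; congr 1; field_simp; ring
    have e6 : x ^ (2 * (r - s) / (2 - s) - 2) = B / x ^ 2 := by
      rw [hB, Real.rpow_sub hx, Real.rpow_two]
    rw [e2, e3, e4, e5, e6]
    have : s ≠ 0 := by linarith
    have : r ≠ 0 := by linarith
    field_simp
    ring

/-- A solution on `(-δ, ∞)`, positive to the left of `0` and vanishing to the right. -/
lemma exists_solution_vanishing_right {s r : ℝ} (hs1 : 1 < s) (hs2 : s < 2) (hr : 2 < r) :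
    ∃ δ > (0 : ℝ), ∃ y z : ℝ → ℝ,
      (∀ t, -δ < t → HasDerivAt y (z t) t ∧
        HasDerivAt z (y t + |y t| ^ (s - 2) * y t - |y t| ^ (r - 2) * y t) t) ∧
      (∀ t, -δ < t → t < 0 → 0 < y t) ∧ ∀ t, 0 ≤ t → y t = 0 := by
  have h2s : 0 < 2 - s := by linarith
  set β := 2 / (2 - s) with hβdef
  set p := 2 * (r - s) / (2 - s) with hpdef
  have hβ : 2 < β := by rw [hβdef, lt_div_iff₀ h2s]; linarith
  have hp : 2 < p := by rw [hpdef, lt_div_iff₀ h2s]; linarith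
  set H : ℝ → ℝ := fun x => 2 / s + x ^ 2 - 2 / r * |x| ^ p with hH
  have hHpos : ∀ x, |x| < 1 → 0 < H x := by
    intro x hx
    have h1 : 1 < 2 / s := by rw [lt_div_iff₀ (by linarith)]; linarith
    have h2 : 2 / r < 1 := by rw [div_lt_one (by linarith)]; linarith
    have h3 : |x| ^ p ≤ 1 := Real.rpow_le_one (abs_nonneg x) hx.le (by linarith)
    have h4 : 0 ≤ |x| ^ p := by positivity
    have h5 : 0 < 2 / r := by positivity
    simp only [hH]
    nlinarith [sq_nonneg x]
  have hHderiv : ∀ x, HasDerivAt H (2 * x - 2 / r * (p * |x| ^ (p - 2) * x)) x := by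
    intro x
    have := ((hasDerivAt_pow 2 x).const_add (2 / s)).sub
      ((hasDerivAt_abs_rpow x (by linarith : 1 < p)).const_mul (2 / r))
    exact this.congr_deriv (by simp)
  have hHC : ContDiff ℝ 1 H := by
    have : ContDiff ℝ 1 fun x : ℝ => |x| ^ p := contDiff_norm_rpow (E := ℝ) (by linarith)
    simp only [hH]
    fun_prop
  have hfC : ContDiffAt ℝ 1 (fun x => -((2 - s) / 2 * √(H x))) 0 :=
    (contDiffAt_const.mul (hHC.contDiffAt.sqrt (hHpos 0 (by simp)).ne')).neg
  obtain ⟨w, hw0, ε, hε, hw⟩ :=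
    hfC.exists_forall_mem_closedBall_exists_eq_forall_mem_Ioo_hasDerivAt₀ 0
  simp only [zero_sub, zero_add] at hw
  have hwsmall : ∀ᶠ t in nhds (0 : ℝ), |w t| < 1 := by
    have hc : ContinuousAt (fun t => |w t|) 0 := (hw 0 (by simp [hε])).continuousAt.abs
    exact hc.eventually_lt_const (by simp [hw0])
  obtain ⟨η, hη, hwη⟩ := Metric.eventually_nhds_iff.1 hwsmall
  set δ := min ε η
  have hδ : 0 < δ := lt_min hε hη
  replace hw : ∀ t ∈ Ioo (-δ) δ, HasDerivAt w (-((2 - s) / 2 * √(H (w t)))) t := fun t ht =>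
    hw t ⟨by linarith [ht.1, min_le_left ε η], ht.2.trans_le (min_le_left _ _)⟩
  replace hwη : ∀ t ∈ Ioo (-δ) δ, 0 < H (w t) := fun t ht => hHpos _ <| hwη <| by
    rw [Real.dist_eq, sub_zero]
    exact (abs_lt.2 ht).trans_le (min_le_right _ _)
  have hanti : StrictAntiOn w (Ioo (-δ) δ) := by
    refine strictAntiOn_of_deriv_neg (convex_Ioo _ _)
      (fun t ht => (hw t ht).continuousAt.continuousWithinAt) fun t ht => ?_
    rw [interior_Ioo] at ht
    rw [(hw t ht).deriv, neg_lt_zero]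
    have := Real.sqrt_pos.2 (hwη t ht)
    positivity
  have h0mem : (0 : ℝ) ∈ Ioo (-δ) δ := by simp [hδ]
  have hwpos : ∀ t, -δ < t → t < 0 → 0 < w t := fun t h1 h2 => by
    simpa [hw0] using hanti ⟨h1, h2.trans hδ⟩ h0mem h2
  have hwnonpos : ∀ t, 0 ≤ t → t < δ → w t ≤ 0 := fun t h1 h2 => by
    simpa [hw0] using hanti.antitoneOn h0mem ⟨by linarith, h2⟩ h1
  set Y : ℝ → ℝ := fun t => max (w t) 0 ^ β with hY
  set Z : ℝ → ℝ := fun t => β * max (w t) 0 ^ (β - 1) * -((2 - s) / 2 * √(H (w t))) with hZ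
  have hYderiv : ∀ t ∈ Ioo (-δ) δ, HasDerivAt Y (Z t) t := fun t ht =>
    (hasDerivAt_max_zero_rpow (w t) (by linarith : 1 < β)).comp t (hw t ht)
  have hZderiv : ∀ t ∈ Ioo (-δ) δ,
      HasDerivAt Z (Y t + |Y t| ^ (s - 2) * Y t - |Y t| ^ (r - 2) * Y t) t := by
    intro t ht
    have h1 : HasDerivAt (fun t => β * max (w t) 0 ^ (β - 1)) _ t :=
      ((hasDerivAt_max_zero_rpow (w t) (by linarith : 1 < β - 1)).comp t (hw t ht)).const_mul β
    have h2 := ((((hHderiv (w t)).comp t (hw t ht)).sqrt (hwη t ht).ne').const_mul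
      ((2 - s) / 2)).neg
    refine (h1.mul h2).congr_deriv ?_
    have hid := mixed_power_identity (x := w t) hs1 hs2 hr
    rw [← hβdef, ← hpdef] at hid
    simp only [hY]
    rw [← hid]
    have hsq : √(H (w t)) ^ 2 = H (w t) := Real.sq_sqrt (hwη t ht).le
    have hne : √(H (w t)) ≠ 0 := (Real.sqrt_pos.2 (hwη t ht)).ne'
    change _ = β * ((β - 1) * max (w t) 0 ^ (β - 1 - 1)) * (((2 - s) / 2) ^ 2 * H (w t)) + _
    simp only [Function.comp_apply, Pi.neg_apply]
    generalize √(H (w t)) = q at hsq hne ⊢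
    rw [← hsq]
    field_simp
  have hYzero : ∀ t, 0 ≤ t → t < δ → Y t = 0 := fun t h1 h2 => by
    simp only [hY]
    rw [max_eq_right (hwnonpos t h1 h2), Real.zero_rpow (by linarith)]
  have hZzero : ∀ t, 0 ≤ t → t < δ → Z t = 0 := fun t h1 h2 => by
    simp only [hZ]
    rw [max_eq_right (hwnonpos t h1 h2), Real.zero_rpow (by linarith)]
    simp
  refine ⟨δ, hδ, fun t => if t < 0 then Y t else 0, fun t => if t < 0 then Z t else 0,
    fun t ht => ?_, fun t h1 h2 => ?_, fun t h => if_neg h.not_gt⟩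
  · rcases lt_or_ge t δ with htδ | htδ
    · have hyY : ∀ τ, τ < δ → (if τ < 0 then Y τ else 0) = Y τ := fun τ hτ => by
        split_ifs with h
        · rfl
        · exact (hYzero τ (not_lt.1 h) hτ).symm
      have hzZ : ∀ τ, τ < δ → (if τ < 0 then Z τ else 0) = Z τ := fun τ hτ => by
        split_ifs with h
        · rfl
        · exact (hZzero τ (not_lt.1 h) hτ).symm
      simp only [hyY t htδ, hzZ t htδ]
      exact ⟨(hYderiv t ⟨ht, htδ⟩).congr_of_eventuallyEq
          (Filter.eventually_of_mem (Iio_mem_nhds htδ) hyY),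
        (hZderiv t ⟨ht, htδ⟩).congr_of_eventuallyEq
          (Filter.eventually_of_mem (Iio_mem_nhds htδ) hzZ)⟩
    · have ht0 : 0 < t := hδ.trans_le htδ
      have hzero : ∀ f : ℝ → ℝ, HasDerivAt (fun t => if t < 0 then f t else 0) 0 t := fun f =>
        (hasDerivAt_const t (0 : ℝ)).congr_of_eventuallyEq
          (Filter.eventually_of_mem (Ioi_mem_nhds ht0) fun τ hτ =>
            if_neg (not_lt.2 (le_of_lt hτ)))
      simpa [ht0.not_gt] using And.intro (hzero Y) (hzero Z)
  · simp only [if_pos h2, hY]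
    exact Real.rpow_pos_of_pos (lt_max_of_lt_left (hwpos t h1 h2)) _

/-- failure of unique continuation for the mixed ODE. Let
`1 < s < 2 < r`. Then there are `T > 0` and a continuously differentiable function
`u : [0,∞) → ℝ`, twice differentiable on `(0,∞)`, which is not identically zero, has
`u(0) > 0`, solves `−u'' + u = |u|^{r−2}u − |u|^{s−2}u` on `(0,∞)`, and vanishes
identically for `t ≥ T`. (Powers `|u|^{r−2}u`, `|u|^{s−2}u` are `0` where `u = 0`.) -/
theorem compactly_supported_ode_solution
    (s r : ℝ) (hs1 : 1 < s) (hs2 : s < 2) (hr : 2 < r) :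
    ∃ T : ℝ, 0 < T ∧ ∃ u : ℝ → ℝ,
      ContDiffOn ℝ 1 u (Set.Ici (0 : ℝ)) ∧
      (∀ t ∈ Set.Ioi (0 : ℝ), DifferentiableAt ℝ (deriv u) t) ∧
      (∃ t ∈ Set.Ici (0 : ℝ), u t ≠ 0) ∧
      0 < u 0 ∧
      (∀ t ∈ Set.Ioi (0 : ℝ),
        -(deriv (deriv u) t) + u t = |u t| ^ (r - 2) * u t - |u t| ^ (s - 2) * u t) ∧
      (∀ t : ℝ, T ≤ t → u t = 0) := by
  obtain ⟨δ, hδ, y, z, hyz, hpos, hzero⟩ := exists_solution_vanishing_right hs1 hs2 hr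
  have hu : ∀ t, -(δ / 2) < t → HasDerivAt (fun t => y (t - δ / 2)) (z (t - δ / 2)) t :=
    fun t ht => (hyz _ (by linarith)).1.comp_sub_const t _
  have hz : ∀ t, -(δ / 2) < t → HasDerivAt (fun t => z (t - δ / 2)) _ t :=
    fun t ht => (hyz _ (by linarith)).2.comp_sub_const t _
  have hdu : ∀ t, -(δ / 2) < t → HasDerivAt (deriv fun t => y (t - δ / 2)) _ t := fun t ht =>
    (hz t ht).congr_of_eventuallyEq
      (Filter.eventually_of_mem (Ioi_mem_nhds ht) fun τ hτ => (hu τ hτ).deriv)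
  have hu0 : 0 < y (0 - δ / 2) := hpos _ (by linarith) (by linarith)
  refine ⟨δ / 2, by linarith, fun t => y (t - δ / 2), ?_, fun t ht => ?_, ⟨0, by simp, hu0.ne'⟩,
    hu0, fun t ht => ?_, fun t ht => hzero _ (by linarith)⟩
  · have hC : ContDiffOn ℝ (0 + 1) (fun t => y (t - δ / 2)) (Ioi (-(δ / 2))) :=
      (contDiffOn_succ_iff_deriv_of_isOpen isOpen_Ioi).2
        ⟨fun t ht => (hu t ht).differentiableAt.differentiableWithinAt, by simp,
          contDiffOn_zero.2 fun t ht => (hdu t ht).continuousAt.continuousWithinAt⟩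
    rw [zero_add] at hC
    exact hC.mono fun t (ht : 0 ≤ t) => show -(δ / 2) < t by linarith
  · exact (hdu t (by linarith [mem_Ioi.1 ht])).differentiableAt
  · rw [(hdu t (by linarith [mem_Ioi.1 ht])).deriv]
    ring
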